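/- For every Q₁=(q₁,q₂), Q₃=(q₅,q₆) ∈ {0,1}², every middle string A = (0, A₁) with A₁ ∈ {0,1}, every x⃗=(x₁,x₂,x₃) ∈ {0,1}³ of even Hamming weight, every sign s ∈ {+1,−1}, and all bits i,j,k,l ∈ {0,1} with i+j even and k+l even, the 6-qubit vector v_{A,x⃗,s} satisfies (P_k ⊗ P_l ⊗ P_i ⊗ P_j ⊗ I ⊗ I) v_{A,x⃗,s} = s · (−1)^{x₂} · (√−1)^{i+j+k+l} · (−1)^{k q₁ + l q₂ + i A₁} · v_{A,x⃗,s}. (The sign (−1)^{x₂} reproduces exactly the four cases x⃗ = (0,0,0), (1,0,1), (0,1,1), (1,1,0) listed in the paper, with signs +, +, −, − respectively.) -/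

import Mathlib

open Matrix Complex

noncomputable section

/-- Single-qubit Pauli X. -/
def Xg : Matrix (Fin 2) (Fin 2) ℂ := !![0, 1; 1, 0]
/-- Single-qubit Pauli Y. -/
def Yg : Matrix (Fin 2) (Fin 2) ℂ := !![0, -Complex.I; Complex.I, 0]
/-- Single-qubit Pauli Z. -/
def Zg : Matrix (Fin 2) (Fin 2) ℂ := !![1, 0; 0, -1]
/-- P₀ = X, P₁ = Y. -/
def Pg : Fin 2 → Matrix (Fin 2) (Fin 2) ℂ := fun i => if i = 0 then Xg else Yg

/-- Tensor (Kronecker) product of `n` single-qubit operators, as a matrix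
indexed by bit strings. -/
def tens {n : ℕ} (M : Fin n → Matrix (Fin 2) (Fin 2) ℂ) :
    Matrix (Fin n → Fin 2) (Fin n → Fin 2) ℂ :=
  Matrix.of fun r c => ∏ m, M m (r m) (c m)

/-- Computational basis vector |q⟩. -/
def ket {n : ℕ} (q : Fin n → Fin 2) : (Fin n → Fin 2) → ℂ :=
  fun r => if r = q then 1 else 0

/-- The eigenvector v_{A,x⃗,s} of the paper (6 qubits), with A = (0, A₁). -/
def vA (q₁ q₂ q₅ q₆ A₁ x₁ x₂ x₃ : Fin 2) (s : ℂ) : (Fin 6 → Fin 2) → ℂ :=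
  (ket ![q₁, q₂, 0, A₁, q₅, q₆]
    + ((-1 : ℂ) ^ (x₁ : ℕ)) • ket ![q₁, q₂, 0, A₁, q₅+1, q₆+1]
    + ((-1 : ℂ) ^ (x₂ : ℕ)) • ket ![q₁+1, q₂+1, 0, A₁, q₅, q₆]
    + ((-1 : ℂ) ^ (x₃ : ℕ)) • ket ![q₁+1, q₂+1, 0, A₁, q₅+1, q₆+1])
  + s • (ket ![q₁, q₂, 1, A₁+1, q₅, q₆]
    + ((-1 : ℂ) ^ (x₁ : ℕ)) • ket ![q₁, q₂, 1, A₁+1, q₅+1, q₆+1]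
    + ((-1 : ℂ) ^ (x₂ : ℕ)) • ket ![q₁+1, q₂+1, 1, A₁+1, q₅, q₆]
    + ((-1 : ℂ) ^ (x₃ : ℕ)) • ket ![q₁+1, q₂+1, 1, A₁+1, q₅+1, q₆+1])

/-- If each factor `M m` sends `|q m⟩` to `a m • |q' m⟩`, then the tensor product sends `|q⟩` to
`(∏ m, a m) • |q'⟩`. -/
lemma tens_mulVec_ket {n : ℕ} {M : Fin n → Matrix (Fin 2) (Fin 2) ℂ} {q q' : Fin n → Fin 2}
    {a : Fin n → ℂ} (h : ∀ m r, M m r (q m) = if r = q' m then a m else 0) :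
    (tens M).mulVec (ket q) = (∏ m, a m) • ket q' := by
  ext r
  simp only [mulVec, dotProduct, tens, ket, of_apply, mul_ite, mul_one, mul_zero,
    Finset.sum_ite_eq', Finset.mem_univ, if_true, Pi.smul_apply, smul_eq_mul, h]
  split_ifs with hr
  · simp [hr]
  · obtain ⟨m, hm⟩ := Function.ne_iff.mp hr
    exact Finset.prod_eq_zero (Finset.mem_univ m) (if_neg hm)

/-- `P_i |c⟩ = I ^ i * (-1) ^ (i * c) |c + 1⟩`, in coordinates. -/
lemma Pg_apply (i r c : Fin 2) :
    Pg i r c = if r = c + 1 then I ^ (i : ℕ) * (-1) ^ ((i : ℕ) * (c : ℕ)) else 0 := by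
  fin_cases i <;> fin_cases r <;> fin_cases c <;> simp [Pg, Xg, Yg]

lemma tens_Pg_mulVec_ket (i j k l a b c d e f : Fin 2) :
    (tens ![Pg k, Pg l, Pg i, Pg j, 1, 1]).mulVec (ket ![a, b, c, d, e, f]) =
      (I ^ ((i : ℕ) + (j : ℕ) + (k : ℕ) + (l : ℕ)) *
        (-1) ^ ((k : ℕ) * (a : ℕ) + (l : ℕ) * (b : ℕ) + (i : ℕ) * (c : ℕ) + (j : ℕ) * (d : ℕ))) •
        ket ![a + 1, b + 1, c + 1, d + 1, e, f] := by
  rw [tens_mulVec_ket (q' := ![a + 1, b + 1, c + 1, d + 1, e, f])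
    (a := ![I ^ (k : ℕ) * (-1) ^ ((k : ℕ) * (a : ℕ)), I ^ (l : ℕ) * (-1) ^ ((l : ℕ) * (b : ℕ)),
      I ^ (i : ℕ) * (-1) ^ ((i : ℕ) * (c : ℕ)), I ^ (j : ℕ) * (-1) ^ ((j : ℕ) * (d : ℕ)), 1, 1])]
  · congr 1
    simp [Fin.prod_univ_six]
    ring
  · intro m r
    fin_cases m
    exacts [Pg_apply k r a, Pg_apply l r b, Pg_apply i r c, Pg_apply j r d, one_apply, one_apply]

lemma eq_of_even_add {i j : Fin 2} (h : Even ((i : ℕ) + (j : ℕ))) : i = j := by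
  revert h
  fin_cases i <;> fin_cases j <;> simp

/-- Flipping both bits does not change the sign picked up from two equal Pauli factors. -/
lemma neg_one_pow_flip (k a b : Fin 2) :
    (-1 : ℂ) ^ ((k : ℕ) * ((a + 1 : Fin 2) : ℕ) + (k : ℕ) * ((b + 1 : Fin 2) : ℕ)) =
      (-1) ^ ((k : ℕ) * (a : ℕ) + (k : ℕ) * (b : ℕ)) := by
  have h : ∀ k a b : Fin 2, ((k : ℕ) * ((a + 1 : Fin 2) : ℕ) + (k : ℕ) * ((b + 1 : Fin 2) : ℕ)) % 2
      = ((k : ℕ) * (a : ℕ) + (k : ℕ) * (b : ℕ)) % 2 := by decide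
  rw [neg_one_pow_eq_pow_mod_two, h, ← neg_one_pow_eq_pow_mod_two]

theorem stmt11 (q₁ q₂ q₅ q₆ A₁ x₁ x₂ x₃ : Fin 2)
    (hx : Even ((x₁ : ℕ) + (x₂ : ℕ) + (x₃ : ℕ)))
    (s : ℂ) (hs : s = 1 ∨ s = -1)
    (i j k l : Fin 2) (hij : Even ((i : ℕ) + (j : ℕ))) (hkl : Even ((k : ℕ) + (l : ℕ))) :
    (tens ![Pg k, Pg l, Pg i, Pg j, 1, 1]).mulVec (vA q₁ q₂ q₅ q₆ A₁ x₁ x₂ x₃ s) =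
      (s * (-1 : ℂ) ^ (x₂ : ℕ) *
        Complex.I ^ ((i : ℕ) + (j : ℕ) + (k : ℕ) + (l : ℕ)) *
        (-1 : ℂ) ^ ((k : ℕ) * (q₁ : ℕ) + (l : ℕ) * (q₂ : ℕ) + (i : ℕ) * (A₁ : ℕ))) •
        vA q₁ q₂ q₅ q₆ A₁ x₁ x₂ x₃ s := by
  obtain rfl := eq_of_even_add hij
  obtain rfl := eq_of_even_add hkl
  have hx2 : (-1 : ℂ) ^ (x₂ : ℕ) * (-1) ^ (x₂ : ℕ) = 1 := by
    rw [← mul_pow]; norm_num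
  have hx1 : (-1 : ℂ) ^ (x₁ : ℕ) = (-1) ^ (x₂ : ℕ) * (-1) ^ (x₃ : ℕ) := by
    have h := hx.neg_one_pow (α := ℂ)
    have hx3 : (-1 : ℂ) ^ (x₃ : ℕ) * (-1) ^ (x₃ : ℕ) = 1 := by
      rw [← mul_pow]; norm_num
    rw [pow_add, pow_add] at h
    linear_combination (-1 : ℂ) ^ (x₂ : ℕ) * (-1) ^ (x₃ : ℕ) * h
      - (-1 : ℂ) ^ (x₁ : ℕ) * (-1) ^ (x₃ : ℕ) * (-1) ^ (x₃ : ℕ) * hx2 - (-1 : ℂ) ^ (x₁ : ℕ) * hx3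
  have hq := neg_one_pow_flip k q₁ q₂
  have hA := neg_one_pow_flip i 0 A₁
  have h2 (a : Fin 2) : a + 1 + 1 = a := by fin_cases a <;> rfl
  simp only [vA, mulVec_add, mulVec_smul, tens_Pg_mulVec_ket, h2, zero_add,
    show (1 : Fin 2) + 1 = 0 from rfl] at hA ⊢
  simp only [add_assoc ((k : ℕ) * _ + _) ((i : ℕ) * _) ((i : ℕ) * _)]
  simp only [pow_add _ ((k : ℕ) * _ + _) _, hq, hA]
  simp only [Fin.val_zero, mul_zero, zero_add]
  generalize (-1 : ℂ) ^ (x₁ : ℕ) = e₁ at *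
  generalize (-1 : ℂ) ^ (x₂ : ℕ) = e₂ at *
  generalize (-1 : ℂ) ^ (x₃ : ℕ) = e₃ at *
  subst hx1
  ext r
  simp only [Pi.add_apply, Pi.smul_apply, smul_eq_mul]
  rcases hs with rfl | rfl <;> rcases mul_self_eq_one_iff.mp hx2 with rfl | rfl <;> ring
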